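/- Let K be a field of characteristic 0, a,b ≥ 0, and let L(a,b) ⊂ K[X,Y,Z;A,B,C]_{a,b} be the kernel of the contraction operator ι_{a,b} = ∂²/∂X∂A + ∂²/∂Y∂B + ∂²/∂Z∂C. Then the K-linear map ∇ = (∇_{k,l})_{0≤k≤a, 0≤l≤b} from L(a,b) to the direct sum over 0≤k≤a, 0≤l≤b of the spaces of homogeneous polynomials of degree a+b−k−l in X,Y is an isomorphism of K-vector spaces. -/

import Mathlib

open MvPolynomial

/-- The weight function making `MvPolynomial (Fin 2 × Fin 3) K` bigraded: variables
`(0, j)` (thought of as `X, Y, Z`) have weight `(1, 0)` and variables `(1, j)`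
(thought of as `A, B, C`) have weight `(0, 1)`. -/
def biweight : Fin 2 × Fin 3 → ℕ × ℕ := fun p => if p.1 = 0 then (1, 0) else (0, 1)

/-- The contraction operator `ι = ∂²/(∂X∂A) + ∂²/(∂Y∂B) + ∂²/(∂Z∂C)`. -/
noncomputable def contraction {K : Type*} [CommRing K]
    (P : MvPolynomial (Fin 2 × Fin 3) K) : MvPolynomial (Fin 2 × Fin 3) K :=
  ∑ j : Fin 3, pderiv ((0 : Fin 2), j) (pderiv ((1 : Fin 2), j) P)

/-- The substitution `(X, Y, Z; A, B, C) ↦ (X, Y, 0; −Y, X, 0)`. -/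
noncomputable def subXY {K : Type*} [Field K] : Fin 2 × Fin 3 → MvPolynomial (Fin 2) K :=
  fun p =>
    if p.1 = 0 then (if p.2 = 0 then X 0 else if p.2 = 1 then X 1 else 0)
    else (if p.2 = 0 then - X 1 else if p.2 = 1 then X 0 else 0)

/-- `∇_{k,l}P(X,Y) = (1/(k!·l!)) · ∂^{k+l}P/∂Z^k∂C^l (X, Y, 0; −Y, X, 0)`. -/
noncomputable def nabla {K : Type*} [Field K] (k l : ℕ)
    (P : MvPolynomial (Fin 2 × Fin 3) K) : MvPolynomial (Fin 2) K :=
  (((k.factorial * l.factorial : ℕ) : K))⁻¹ •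
    aeval subXY
      ((fun Q => pderiv ((0 : Fin 2), (2 : Fin 3)) Q)^[k]
        ((fun Q => pderiv ((1 : Fin 2), (2 : Fin 3)) Q)^[l] P))


set_option linter.unusedSimpArgs false

section helpers
variable {K : Type*} [Field K]

abbrev R6 (K : Type*) [Field K] := MvPolynomial (Fin 2 × Fin 3) K

lemma pd_comm (i j : Fin 2 × Fin 3) (P : R6 K) :
    pderiv i (pderiv j P) = pderiv j (pderiv i P) := by
  have h : ⁅(pderiv i : Derivation K (R6 K) (R6 K)),
      (pderiv j : Derivation K (R6 K) (R6 K))⁆ = 0 := by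
    apply MvPolynomial.derivation_ext
    intro k
    rw [Derivation.commutator_apply]
    simp only [pderiv_X, Pi.single_apply]
    split_ifs <;> simp
  have h2 := congrArg (fun D => D P) h
  simp only [Derivation.commutator_apply, Derivation.coe_zero, Pi.zero_apply] at h2
  exact sub_eq_zero.mp h2

lemma bw_iff (d : Fin 2 × Fin 3 →₀ ℕ) (a b : ℕ) :
    Finsupp.weight biweight d = (a, b) ↔
      d (0,0) + d (0,1) + d (0,2) = a ∧ d (1,0) + d (1,1) + d (1,2) = b := by
  rw [Finsupp.weight_apply, Finsupp.sum_fintype _ _ (by simp)]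
  simp [Fintype.sum_prod_type, Fin.sum_univ_succ, biweight, Prod.ext_iff, add_assoc]

lemma coeff_wt {a b : ℕ} {P : R6 K} (hP : IsWeightedHomogeneous biweight P (a, b))
    {d : Fin 2 × Fin 3 →₀ ℕ} (hd : coeff d P ≠ 0) :
      d (0,0) + d (0,1) + d (0,2) = a ∧ d (1,0) + d (1,1) + d (1,2) = b :=
  (bw_iff d a b).1 (hP hd)

lemma pd_eq_zero_left {b : ℕ} {P : R6 K} (hP : IsWeightedHomogeneous biweight P (0, b))
    (j : Fin 3) : pderiv (0, j) P = 0 := by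
  apply pderiv_eq_zero_of_notMem_vars
  rw [mem_vars_iff_mem_support]
  rintro ⟨d, hd, h⟩
  have := (coeff_wt hP (mem_support_iff.1 hd)).1
  rw [Finsupp.mem_support_iff] at h
  fin_cases j <;> simp at h <;> omega

lemma pd_eq_zero_right {a : ℕ} {P : R6 K} (hP : IsWeightedHomogeneous biweight P (a, 0))
    (j : Fin 3) : pderiv (1, j) P = 0 := by
  apply pderiv_eq_zero_of_notMem_vars
  rw [mem_vars_iff_mem_support]
  rintro ⟨d, hd, h⟩
  have := (coeff_wt hP (mem_support_iff.1 hd)).2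
  rw [Finsupp.mem_support_iff] at h
  fin_cases j <;> simp at h <;> omega

lemma pd_left {a b : ℕ} {P : R6 K} (hP : IsWeightedHomogeneous biweight P (a + 1, b))
    (j : Fin 3) : IsWeightedHomogeneous biweight (pderiv (0, j) P) (a, b) :=
  hP.pderiv (by simp [biweight])

lemma pd_right {a b : ℕ} {P : R6 K} (hP : IsWeightedHomogeneous biweight P (a, b + 1))
    (j : Fin 3) : IsWeightedHomogeneous biweight (pderiv (1, j) P) (a, b) :=
  hP.pderiv (by simp [biweight])

lemma euler_left {a b : ℕ} {P : R6 K} (hP : IsWeightedHomogeneous biweight P (a, b)) :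
    X (0,0) * pderiv (0,0) P + X (0,1) * pderiv (0,1) P + X (0,2) * pderiv (0,2) P
      = (a : R6 K) * P := by
  have h : IsWeightedHomogeneous (fun p : Fin 2 × Fin 3 => if p.1 = 0 then 1 else 0) P a := by
    intro d hd
    rw [← (coeff_wt hP hd).1, Finsupp.weight_apply, Finsupp.sum_fintype _ _ (by simp)]
    simp [Fintype.sum_prod_type, Fin.sum_univ_succ, add_assoc]
  have := h.sum_weight_X_mul_pderiv
  rw [← nsmul_eq_mul, ← this]
  simp [Fintype.sum_prod_type, Fin.sum_univ_succ, add_assoc]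

lemma euler_right {a b : ℕ} {P : R6 K} (hP : IsWeightedHomogeneous biweight P (a, b)) :
    X (1,0) * pderiv (1,0) P + X (1,1) * pderiv (1,1) P + X (1,2) * pderiv (1,2) P
      = (b : R6 K) * P := by
  have h : IsWeightedHomogeneous (fun p : Fin 2 × Fin 3 => if p.1 = 0 then 0 else 1) P b := by
    intro d hd
    rw [← (coeff_wt hP hd).2, Finsupp.weight_apply, Finsupp.sum_fintype _ _ (by simp)]
    simp [Fintype.sum_prod_type, Fin.sum_univ_succ, add_assoc]
  have := h.sum_weight_X_mul_pderiv
  rw [← nsmul_eq_mul, ← this]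
  simp [Fintype.sum_prod_type, Fin.sum_univ_succ, add_assoc]

lemma ev_homog {a b : ℕ} {P : R6 K} (hP : IsWeightedHomogeneous biweight P (a, b)) :
    (aeval (subXY (K := K)) P).IsHomogeneous (a + b) := by
  have h : P.IsHomogeneous (a + b) := by
    intro d hd
    rw [← (coeff_wt hP hd).1, ← (coeff_wt hP hd).2, Finsupp.weight_apply,
      Finsupp.sum_fintype _ _ (by simp)]
    simp [Fintype.sum_prod_type, Fin.sum_univ_succ, add_assoc]
  have := h.aeval (subXY (K := K)) (n := 1) (by
    rintro ⟨i, j⟩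
    unfold subXY
    dsimp only
    split_ifs
    all_goals first
      | exact isHomogeneous_X _ _
      | exact (isHomogeneous_X _ _).neg
      | exact isHomogeneous_zero _ _ _)
  simpa using this

/-- polarization operator `X ∂_B - Y ∂_A` -/
noncomputable def polT (P : R6 K) : R6 K :=
  X (0,0) * pderiv (1,1) P - X (0,1) * pderiv (1,0) P

noncomputable def polS (P : R6 K) : R6 K :=
  X (1,1) * pderiv (0,0) P - X (1,0) * pderiv (0,1) P

lemma contr_eq (P : R6 K) : contraction P = pderiv (0,0) (pderiv (1,0) P)
    + pderiv (0,1) (pderiv (1,1) P) + pderiv (0,2) (pderiv (1,2) P) := by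
  simp [contraction, Fin.sum_univ_succ, add_assoc]

lemma capelli {a b : ℕ} {P : R6 K} (hP : IsWeightedHomogeneous biweight P (a, b + 1))
    (hZ : pderiv (0,2) P = 0) (hC : pderiv (1,2) P = 0) (h0 : contraction P = 0) :
    polS (polT P) = (((a + 1) * (b + 1) : ℕ) : R6 K) * P := by
  rw [contr_eq, hC, map_zero, add_zero] at h0
  have e0 := euler_left (pd_right hP 0)
  have e1 := euler_left (pd_right hP 1)
  have e := euler_right hP
  rw [hC] at e
  rw [pd_comm (0,2) (1,0), hZ, map_zero] at e0
  rw [pd_comm (0,2) (1,1), hZ, map_zero] at e1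
  simp only [polS, polT, map_sub, Derivation.leibniz, smul_eq_mul, pderiv_X]
  simp [Pi.single_apply]
  push_cast at e
  linear_combination X (1,0) * e0 + X (1,1) * e1 + ((a : R6 K) + 1) * e
    - (X (1,1) * X (0,1) + X (1,0) * X (0,0)) * h0

lemma polT_zero_of {P : R6 K} (i : Fin 2) (h : pderiv (i,2) P = 0) :
    pderiv (i,2) (polT P) = 0 := by
  simp only [polT, map_sub, Derivation.leibniz, smul_eq_mul, pderiv_X]
  rw [pd_comm _ (1,1), pd_comm _ (1,0), h]
  simp [Pi.single_apply]

lemma polT_contr {P : R6 K} (hC : pderiv (1,2) P = 0) (h0 : contraction P = 0) :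
    contraction (polT P) = 0 := by
  have hC' := polT_zero_of 1 hC
  rw [contr_eq, hC, map_zero, add_zero] at h0
  rw [contr_eq, hC']
  have h1 := congrArg (pderiv (1,1)) h0
  have h2 := congrArg (pderiv (1,0)) h0
  simp only [polT, map_sub, map_add, map_zero, Derivation.leibniz, smul_eq_mul, pderiv_X] at *
  simp [Pi.single_apply] at *
  simp only [pd_comm (1,_) (0,_), pd_comm (1,1) (1,0)] at *
  linear_combination X (0,0) * h1 - X (0,1) * h2

lemma polT_wt {a b : ℕ} {P : R6 K} (hP : IsWeightedHomogeneous biweight P (a, b + 1)) :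
    IsWeightedHomogeneous biweight (polT P) (a + 1, b) := by
  have h (j : Fin 3) : IsWeightedHomogeneous biweight (X (0,j) : R6 K) (1, 0) :=
    isWeightedHomogeneous_X K biweight (0, j)
  have e : ((a + 1, b) : ℕ × ℕ) = (1, 0) + (a, b) := by simp [add_comm]
  rw [e]
  exact ((h 0).mul (pd_right hP 1)).sub ((h 1).mul (pd_right hP 0))

lemma ev_polT {a b : ℕ} {P : R6 K} (hP : IsWeightedHomogeneous biweight P (a, b)) :
    aeval (subXY (K := K)) (polT P) = (b : MvPolynomial (Fin 2) K) * aeval subXY P := by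
  have e := congrArg (aeval (subXY (K := K))) (euler_right hP)
  simp [polT, subXY] at *
  linear_combination e

lemma vars_of_pd [CharZero K] {P : R6 K} {i : Fin 2 × Fin 3} (h : pderiv i P = 0)
    {d : Fin 2 × Fin 3 →₀ ℕ} (hd : coeff d P ≠ 0) : d i = 0 := by
  by_contra hi
  have h1 := coeff_pderiv (i := i) P (d - Finsupp.single i 1)
  rw [h, coeff_zero] at h1
  have : d - Finsupp.single i 1 + Finsupp.single i 1 = d := by
    ext j
    by_cases hj : i = j
    · subst hj; simp; omega
    · simp [Finsupp.single_apply, hj]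
  rw [this] at h1
  have h3 := mul_eq_zero.1 h1.symm
  rcases h3 with h3 | h3
  · exact hd h3
  · norm_cast at h3

lemma base_zero [CharZero K] {a : ℕ} {P : R6 K} (hP : IsWeightedHomogeneous biweight P (a, 0))
    (hZ : pderiv (0,2) P = 0) (hev : aeval (subXY (K := K)) P = 0) : P = 0 := by
  let σ : MvPolynomial (Fin 2) K →ₐ[K] R6 K := aeval ![X (0,0), X (0,1)]
  have h : (σ.comp (aeval (subXY (K := K)))).toRingHom P = (RingHom.id (R6 K)) P := by
    apply hom_congr_vars _ _ rfl
    · ext x; simp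
    · rintro ⟨i, j⟩ hi -
      rw [mem_vars_iff_mem_support] at hi
      obtain ⟨d, hd, h⟩ := hi
      rw [mem_support_iff] at hd
      rw [Finsupp.mem_support_iff] at h
      have h1 := (coeff_wt hP hd).2
      have h2 := vars_of_pd hZ hd
      fin_cases i <;> fin_cases j <;> simp at h <;> first | omega | simp [σ, subXY]
  have h' : σ (aeval (subXY (K := K)) P) = P := h
  rw [← h', hev, map_zero]

lemma harm_zero [CharZero K] (b : ℕ) : ∀ (a : ℕ) {P : R6 K}, IsWeightedHomogeneous biweight P (a, b) →
    pderiv (0,2) P = 0 → pderiv (1,2) P = 0 → contraction P = 0 →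
    aeval (subXY (K := K)) P = 0 → P = 0 := by
  induction b with
  | zero => intro a P hP hZ _ _ hev; exact base_zero hP hZ hev
  | succ b ih =>
    intro a P hP hZ hC h0 hev
    have hT : polT P = 0 := ih (a + 1) (polT_wt hP) (polT_zero_of 0 hZ) (polT_zero_of 1 hC)
      (polT_contr hC h0) (by rw [ev_polT hP, hev, mul_zero])
    have hc := capelli hP hZ hC h0
    rw [hT] at hc
    have : polS (0 : R6 K) = 0 := by simp [polS]
    rw [this] at hc
    rcases mul_eq_zero.1 hc.symm with h | h
    · exact absurd h (Nat.cast_ne_zero.2 (by positivity))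
    · exact h

lemma contr_pd {P : R6 K} (i) (h0 : contraction P = 0) : contraction (pderiv i P) = 0 := by
  have h1 := congrArg (pderiv i) h0
  rw [map_zero, contr_eq, map_add, map_add] at h1
  rw [contr_eq, ← h1]
  simp only [pd_comm i]

lemma iter_comm (i j : Fin 2 × Fin 3) (l : ℕ) (P : R6 K) :
    (fun Q => pderiv i Q)^[l] (pderiv j P) = pderiv j ((fun Q => pderiv i Q)^[l] P) :=
  ((show Function.Commute (fun Q : R6 K => pderiv i Q) (fun Q => pderiv j Q) from
    fun Q => pd_comm i j Q).iterate_left l) P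

lemma inj_aux [CharZero K] (N : ℕ) : ∀ (a b : ℕ), a + b = N → ∀ {P : R6 K},
    IsWeightedHomogeneous biweight P (a, b) → contraction P = 0 →
    (∀ k ≤ a, ∀ l ≤ b, aeval (subXY (K := K)) ((fun Q => pderiv ((0 : Fin 2), (2 : Fin 3)) Q)^[k]
        ((fun Q => pderiv ((1 : Fin 2), (2 : Fin 3)) Q)^[l] P)) = 0) → P = 0 := by
  induction N with
  | zero =>
    intro a b hab P hP h0 h
    obtain ⟨rfl, rfl⟩ : a = 0 ∧ b = 0 := by omega
    exact harm_zero 0 0 hP (pd_eq_zero_left hP 2) (pd_eq_zero_right hP 2) h0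
      (h 0 le_rfl 0 le_rfl)
  | succ N ih =>
    intro a b hab P hP h0 h
    refine harm_zero b a hP ?_ ?_ h0 (h 0 (Nat.zero_le _) 0 (Nat.zero_le _))
    · rcases a with _ | a
      · exact pd_eq_zero_left hP 2
      · apply ih a b (by omega) (pd_left hP 2) (contr_pd _ h0)
        intro k hk l hl
        have := h (k + 1) (by omega) l hl
        rw [Function.iterate_succ_apply] at this
        rw [iter_comm]
        exact this
    · rcases b with _ | b
      · exact pd_eq_zero_right hP 2
      · apply ih a b (by omega) (pd_right hP 2) (contr_pd _ h0)
        intro k hk l hl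
        exact h k hk (l + 1) (by omega)

lemma iter_left (k : ℕ) : ∀ {a b : ℕ} {P : R6 K}, IsWeightedHomogeneous biweight P (a + k, b) →
    IsWeightedHomogeneous biweight ((fun Q => pderiv ((0 : Fin 2), (2 : Fin 3)) Q)^[k] P) (a, b) := by
  induction k with
  | zero => intro a b P h; exact h
  | succ k ih => intro a b P h; exact ih (pd_left (by rwa [add_assoc]) 2)

lemma iter_right (k : ℕ) : ∀ {a b : ℕ} {P : R6 K}, IsWeightedHomogeneous biweight P (a, b + k) →
    IsWeightedHomogeneous biweight ((fun Q => pderiv ((1 : Fin 2), (2 : Fin 3)) Q)^[k] P) (a, b) := by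
  induction k with
  | zero => intro a b P h; exact h
  | succ k ih => intro a b P h; exact ih (pd_right (by rwa [add_assoc]) 2)

lemma nabla_mem {a b k l : ℕ} (hk : k ≤ a) (hl : l ≤ b) {P : R6 K}
    (hP : IsWeightedHomogeneous biweight P (a, b)) :
    nabla k l P ∈ homogeneousSubmodule (Fin 2) K (a + b - k - l) := by
  apply Submodule.smul_mem
  obtain ⟨a, rfl⟩ := Nat.exists_eq_add_of_le' hk
  obtain ⟨b, rfl⟩ := Nat.exists_eq_add_of_le' hl
  have := ev_homog (iter_left k (iter_right l hP))
  rw [mem_homogeneousSubmodule]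
  convert this using 1
  omega

end helpers

section dims
variable {K : Type*} [Field K]

lemma finrank_wh {σ M : Type*} [AddCommMonoid M] (w : σ → M) (m : M) :
    Module.finrank K (weightedHomogeneousSubmodule K w m)
      = Nat.card {d : σ →₀ ℕ // Finsupp.weight w d = m} := by
  rw [weightedHomogeneousSubmodule_eq_finsupp_supported]
  exact Module.finrank_eq_nat_card_basis
    (basisRestrictSupport K {d : σ →₀ ℕ | Finsupp.weight w d = m})

lemma finite_wh {σ M : Type*} [AddCommMonoid M] (w : σ → M) (m : M)
    [Finite {d : σ →₀ ℕ // Finsupp.weight w d = m}] :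
    Module.Finite K (weightedHomogeneousSubmodule K w m) := by
  have : Finite ↑{d : σ →₀ ℕ | Finsupp.weight w d = m} :=
    inferInstanceAs (Finite {d : σ →₀ ℕ // Finsupp.weight w d = m})
  rw [weightedHomogeneousSubmodule_eq_finsupp_supported]
  exact Module.Finite.of_basis
    (basisRestrictSupport K {d : σ →₀ ℕ | Finsupp.weight w d = m})

noncomputable def biEquiv (a b : ℕ) :
    {d : Fin 2 × Fin 3 →₀ ℕ // Finsupp.weight biweight d = (a, b)} ≃
      Sym (Fin 3) a × Sym (Fin 3) b :=
  Equiv.trans (β := {f : Fin 3 → ℕ // ∑ i, f i = a} × {f : Fin 3 → ℕ // ∑ i, f i = b})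
    { toFun := fun d => (⟨fun j => d.1 (0, j), by
          have := ((bw_iff d.1 a b).1 d.2).1
          simpa [Fin.sum_univ_succ, add_assoc] using this⟩,
        ⟨fun j => d.1 (1, j), by
          have := ((bw_iff d.1 a b).1 d.2).2
          simpa [Fin.sum_univ_succ, add_assoc] using this⟩)
      invFun := fun p => ⟨Finsupp.equivFunOnFinite.symm
          (fun x => if x.1 = 0 then p.1.1 x.2 else p.2.1 x.2), by
          have h1 := p.1.2
          have h2 := p.2.2
          rw [bw_iff]
          simp [Fin.sum_univ_succ, add_assoc] at h1 h2 ⊢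
          exact ⟨h1, h2⟩⟩
      left_inv := by
        rintro ⟨d, hd⟩
        ext ⟨i, j⟩
        fin_cases i <;> simp
      right_inv := by
        rintro ⟨⟨f, hf⟩, ⟨g, hg⟩⟩
        simp }
    (Equiv.prodCongr (Sym.equivNatSumOfFintype (Fin 3) a).symm
      (Sym.equivNatSumOfFintype (Fin 3) b).symm)

lemma finrank_bi (a b : ℕ) :
    Module.finrank K (weightedHomogeneousSubmodule K biweight (a, b))
      = (a + 2).choose 2 * (b + 2).choose 2 := by
  rw [finrank_wh, Nat.card_congr (biEquiv a b), Nat.card_prod, Nat.card_eq_fintype_card,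
    Nat.card_eq_fintype_card, Sym.card_sym_eq_choose, Sym.card_sym_eq_choose, Fintype.card_fin]
  congr 1
  · rw [show 3 + a - 1 = a + 2 by omega, ← Nat.choose_symm_add]
  · rw [show 3 + b - 1 = b + 2 by omega, ← Nat.choose_symm_add]

instance finite_bi (a b : ℕ) :
    Module.Finite K (weightedHomogeneousSubmodule K biweight (a, b)) := by
  have : Finite {d : Fin 2 × Fin 3 →₀ ℕ // Finsupp.weight biweight d = (a, b)} :=
    Finite.of_equiv _ (biEquiv a b).symm
  exact finite_wh _ _

noncomputable def homEquiv (n : ℕ) :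
    {d : Fin 2 →₀ ℕ // Finsupp.weight (1 : Fin 2 → ℕ) d = n} ≃ Sym (Fin 2) n :=
  Equiv.trans (Equiv.subtypeEquiv Finsupp.equivFunOnFinite (by
      intro d
      rw [Finsupp.weight_apply, Finsupp.sum_fintype _ _ (by simp)]
      simp))
    (Sym.equivNatSumOfFintype (Fin 2) n).symm

lemma finrank_hom (n : ℕ) :
    Module.finrank K (homogeneousSubmodule (Fin 2) K n) = n + 1 := by
  rw [← weightedHomogeneousSubmodule_one, finrank_wh, Nat.card_congr (homEquiv n),
    Nat.card_eq_fintype_card, Sym.card_sym_eq_choose, Fintype.card_fin,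
    show 2 + n - 1 = n + 1 by omega, Nat.choose_succ_self_right]

instance finite_hom (n : ℕ) : Module.Finite K (homogeneousSubmodule (Fin 2) K n) := by
  rw [← weightedHomogeneousSubmodule_one]
  have : Finite {d : Fin 2 →₀ ℕ // Finsupp.weight (1 : Fin 2 → ℕ) d = n} :=
    Finite.of_equiv _ (homEquiv n).symm
  exact finite_wh _ _

noncomputable def contrL : R6 K →ₗ[K] R6 K :=
  ∑ j : Fin 3, (pderiv ((0 : Fin 2), j)).toLinearMap ∘ₗ (pderiv ((1 : Fin 2), j)).toLinearMap

lemma contrL_apply (P : R6 K) : contrL P = contraction P := by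
  simp [contrL, contraction]

lemma contr_range (a b : ℕ) :
    Module.finrank K (LinearMap.range
      ((contrL (K := K)).domRestrict (weightedHomogeneousSubmodule K biweight (a, b))))
      ≤ (a + 1).choose 2 * (b + 1).choose 2 := by
  rcases a with _ | a
  · have : (contrL (K := K)).domRestrict (weightedHomogeneousSubmodule K biweight (0, b)) = 0 := by
      ext1 ⟨P, hP⟩
      simp only [LinearMap.domRestrict_apply, contrL_apply, contr_eq]
      simp only [pd_comm (0,_) (1,_), pd_eq_zero_left hP]
      simp
    rw [this]; simp
  rcases b with _ | b
  · have : (contrL (K := K)).domRestrict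
        (weightedHomogeneousSubmodule K biweight (a + 1, 0)) = 0 := by
      ext1 ⟨P, hP⟩
      simp only [LinearMap.domRestrict_apply, contrL_apply, contr_eq, pd_eq_zero_right hP]
      simp
    rw [this]; simp
  rw [← finrank_bi (K := K) a b]
  apply Submodule.finrank_mono
  rintro _ ⟨⟨P, hP⟩, rfl⟩
  simp only [LinearMap.domRestrict_apply, contrL_apply, contr_eq]
  have h (j : Fin 3) := pd_left (pd_right hP j) j
  exact ((h 0).add (h 1)).add (h 2)

lemma sum_aux (c : ℤ) (n : ℕ) : 2 * ∑ l ∈ Finset.range n, (c - l) = n * (2 * c - n + 1) := by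
  induction n with
  | zero => simp
  | succ n ih => rw [Finset.sum_range_succ, mul_add, ih]; push_cast; ring

lemma choose_aux (n : ℕ) : 2 * (n + 1).choose 2 = n * (n + 1) := by
  induction n with
  | zero => simp
  | succ n ih => rw [Nat.choose_succ_succ' (n + 1) 1, mul_add, ih, Nat.choose_one_right]; ring

lemma count (a b : ℕ) :
    ∑ p : Fin (a + 1) × Fin (b + 1), (a + b - (p.1 : ℕ) - (p.2 : ℕ) + 1)
      + (a + 1).choose 2 * (b + 1).choose 2 = (a + 2).choose 2 * (b + 2).choose 2 := by
  have h : 2 * ((∑ p : Fin (a + 1) × Fin (b + 1), (a + b - (p.1 : ℕ) - (p.2 : ℕ) + 1) : ℕ) : ℤ)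
      = (a + 1) * (b + 1) * (a + b + 2) := by
    have e1 : ((∑ p : Fin (a + 1) × Fin (b + 1), (a + b - (p.1 : ℕ) - (p.2 : ℕ) + 1) : ℕ) : ℤ)
        = ∑ k ∈ Finset.range (a + 1), ∑ l ∈ Finset.range (b + 1),
            (((a : ℤ) + b + 1 - k) - l) := by
      rw [Fintype.sum_prod_type, Nat.cast_sum,
        ← Fin.sum_univ_eq_sum_range (fun k => ∑ l ∈ Finset.range (b + 1),
            (((a : ℤ) + b + 1 - k) - l))]
      apply Finset.sum_congr rfl
      intro k _
      rw [Nat.cast_sum, ← Fin.sum_univ_eq_sum_range (fun l => (((a : ℤ) + b + 1 - k) - l))]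
      apply Finset.sum_congr rfl
      intro l _
      have := k.2
      have := l.2
      dsimp only
      omega
    rw [e1, Finset.mul_sum]
    simp only [sum_aux]
    have e2 : ∀ k : ℕ, ((b + 1 : ℕ) : ℤ) * (2 * ((a : ℤ) + b + 1 - k) - ((b + 1 : ℕ) : ℤ) + 1)
        = ((b : ℤ) + 1) * (2 * ((((a : ℤ) + b + 1)) - k) - b) := by
      intro k; push_cast; ring
    simp only [e2]
    rw [← Finset.mul_sum, Finset.sum_sub_distrib, ← Finset.mul_sum, sum_aux]
    simp
    ring
  have c1 := choose_aux a
  have c2 := choose_aux b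
  have c3 := choose_aux (a + 1)
  have c4 := choose_aux (b + 1)
  zify at *
  have : (4 : ℤ) ≠ 0 := by norm_num
  apply mul_left_cancel₀ this
  push_cast at *
  linear_combination 2 * h + 2 * ((b + 1).choose 2 : ℤ) * c1 + (a : ℤ) * (a + 1) * c2
    - 2 * ((b + 2).choose 2 : ℤ) * c3 - ((a : ℤ) + 1) * (a + 2) * c4

noncomputable def nablaL (k l : ℕ) : R6 K →ₗ[K] MvPolynomial (Fin 2) K :=
  (((k.factorial * l.factorial : ℕ) : K))⁻¹ • ((aeval (subXY (K := K))).toLinearMap ∘ₗ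
    ((pderiv ((0 : Fin 2), (2 : Fin 3))).toLinearMap ^ k) ∘ₗ
    ((pderiv ((1 : Fin 2), (2 : Fin 3))).toLinearMap ^ l))

lemma nablaL_apply (k l : ℕ) (P : R6 K) : nablaL k l P = nabla k l P := by
  simp only [nablaL, nabla, LinearMap.smul_apply, LinearMap.comp_apply, Module.End.pow_apply]
  rfl

end dims


lemma surj_general {K E G ι : Type*} [Field K] [AddCommGroup E] [Module K E] [AddCommGroup G]
    [Module K G] [Fintype ι] (V : Submodule K E) [Module.Finite K V] (φ : E →ₗ[K] E)
    (W : ι → Submodule K G) [∀ i, Module.Finite K (W i)] (f : ι → E →ₗ[K] G)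
    (hmem : ∀ i, ∀ x ∈ V, f i x ∈ W i)
    (hinj : ∀ x ∈ V, φ x = 0 → (∀ i, f i x = 0) → x = 0)
    (hle : ∑ i, Module.finrank K (W i) + Module.finrank K (LinearMap.range (φ.domRestrict V))
      ≤ Module.finrank K V)
    (g : ι → G) (hg : ∀ i, g i ∈ W i) : ∃ x ∈ V, φ x = 0 ∧ ∀ i, f i x = g i := by
  let F : LinearMap.ker (φ.domRestrict V) →ₗ[K] ((i : ι) → W i) :=
    LinearMap.pi fun i => LinearMap.codRestrict _
      ((f i) ∘ₗ V.subtype ∘ₗ (LinearMap.ker (φ.domRestrict V)).subtype)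
      (fun x => hmem i _ x.1.2)
  have hFinj : Function.Injective F := by
    rw [← LinearMap.ker_eq_bot, LinearMap.ker_eq_bot']
    intro x hx
    apply Subtype.ext
    apply Subtype.ext
    apply hinj _ x.1.2 x.2
    intro i
    exact congrArg Subtype.val (congrFun hx i)
  have h1 := LinearMap.finrank_range_add_finrank_ker (φ.domRestrict V)
  have h2 := Module.finrank_pi_fintype K (M := fun i => W i)
  have h3 := LinearMap.finrank_le_finrank_of_injective hFinj
  have hFsurj : Function.Surjective F :=
    (LinearMap.injective_iff_surjective_of_finrank_eq_finrank (by omega)).1 hFinj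
  obtain ⟨x, hx⟩ := hFsurj (fun i => ⟨g i, hg i⟩)
  exact ⟨x.1.1, x.1.2, x.2, fun i => congrArg Subtype.val (congrFun hx i)⟩

/-- The map `∇ = (∇_{k,l})_{0≤k≤a, 0≤l≤b}` restricts to a bijection (hence, being
`K`-linear, an isomorphism of `K`-vector spaces) from the kernel `L(a,b)` of the
contraction operator on bihomogeneous polynomials of bidegree `(a, b)` onto the
direct sum of the spaces of homogeneous polynomials of degree `a + b − k − l`
in `X, Y`. -/
theorem nabla_bijective (K : Type*) [Field K] [CharZero K] (a b : ℕ) :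
    Set.BijOn
      (fun (P : MvPolynomial (Fin 2 × Fin 3) K) (p : Fin (a + 1) × Fin (b + 1)) =>
        nabla (p.1 : ℕ) (p.2 : ℕ) P)
      {P | P ∈ weightedHomogeneousSubmodule K biweight (a, b) ∧ contraction P = 0}
      {f : Fin (a + 1) × Fin (b + 1) → MvPolynomial (Fin 2) K |
        ∀ p, f p ∈ homogeneousSubmodule (Fin 2) K (a + b - (p.1 : ℕ) - (p.2 : ℕ))} := by
  have hker : ∀ P : MvPolynomial (Fin 2 × Fin 3) K,
      P ∈ weightedHomogeneousSubmodule K biweight (a, b) → contraction P = 0 →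
      (∀ p : Fin (a + 1) × Fin (b + 1), nabla (p.1 : ℕ) (p.2 : ℕ) P = 0) → P = 0 := by
    intro P hP h0 h
    apply inj_aux (a + b) a b rfl hP h0
    intro k hk l hl
    have := h (⟨k, by omega⟩, ⟨l, by omega⟩)
    unfold nabla at this
    rcases smul_eq_zero.1 this with h' | h'
    · exact absurd h' (inv_ne_zero (Nat.cast_ne_zero.2 (by positivity)))
    · exact h'
  refine ⟨?_, ?_, ?_⟩
  · rintro P ⟨hP, h0⟩ p
    exact nabla_mem (by omega) (by omega) hP
  · rintro P ⟨hP, h0⟩ Q ⟨hQ, h0'⟩ h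
    rw [← sub_eq_zero]
    apply hker _ (Submodule.sub_mem _ hP hQ)
    · rw [← contrL_apply, map_sub, contrL_apply, contrL_apply, h0, h0', sub_zero]
    · intro p
      rw [← nablaL_apply, map_sub, nablaL_apply, nablaL_apply, sub_eq_zero]
      exact congrFun h p
  · intro f hf
    obtain ⟨x, hxV, hx0, hx⟩ := surj_general (weightedHomogeneousSubmodule K biweight (a, b))
      (contrL (K := K))
      (fun p : Fin (a + 1) × Fin (b + 1) =>
        homogeneousSubmodule (Fin 2) K (a + b - (p.1 : ℕ) - (p.2 : ℕ)))
      (fun p => nablaL (p.1 : ℕ) (p.2 : ℕ))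
      (by
        intro p x hx
        rw [nablaL_apply]
        exact nabla_mem (by omega) (by omega) hx)
      (by
        intro x hx h0 h
        rw [contrL_apply] at h0
        exact hker x hx h0 (fun p => by rw [← nablaL_apply]; exact h p))
      (by
        simp only [finrank_hom]
        rw [finrank_bi, ← count a b]
        exact Nat.add_le_add_left (contr_range (K := K) a b) _)
      f hf
    refine ⟨x, ⟨hxV, ?_⟩, ?_⟩
    · rw [← contrL_apply]; exact hx0
    · funext p
      dsimp only
      rw [← nablaL_apply]
      exact hx p
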